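/- arXiv:math/0201230 — 6 statements merged into one kernel-verified Lean document; each statement's English description precedes it below -/
import Mathlib

section
/- Let B be a paracompact Hausdorff topological space, let M be a topological space with a continuous action of the additive group ℝ, and let π : M → B be a continuous map which is a principal ℝ-bundle: every point of B has an open neighborhood U together with a homeomorphism τ : U × ℝ → π⁻¹(U) satisfying π(τ(u,t)) = u and τ(u, t+s) = s · τ(u,t) for all u ∈ U and s,t ∈ ℝ. Then the bundle is trivial: there exists a continuous global section s : B → M with π ∘ s = id_B, and the map B × ℝ → M, (b,t) ↦ t · s(b), is a homeomorphism intertwining the ℝ-action on M with translation in the ℝ-factor. -/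
open Set Function Topology

/-- A local trivialization of a principal `ℝ`-bundle, recorded as a local section together with
the equivariant fiber coordinate it induces. -/
lemma exists_local_section_and_coordinate
    {B M : Type*} [TopologicalSpace B] [TopologicalSpace M] [AddAction ℝ M]
    {π : M → B} {U : Set B} (τ : (U × ℝ) ≃ₜ (π ⁻¹' U))
    (hτ : ∀ (u : U) (t : ℝ), π ((τ (u, t) : M)) = (u : B))
    (hτadd : ∀ (u : U) (t s : ℝ), ((τ (u, t + s) : M)) = s +ᵥ ((τ (u, t) : M))) :
    ∃ (σ : U → M) (g : M → ℝ), Continuous σ ∧ ContinuousOn g (π ⁻¹' U) ∧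
      (∀ u, π (σ u) = u) ∧ (∀ (u : U) (t : ℝ), π (t +ᵥ σ u) = u) ∧
      (∀ (u : U) (t : ℝ), g (t +ᵥ σ u) = t) ∧
      ∀ (m : M) (hm : π m ∈ U), m = g m +ᵥ σ ⟨π m, hm⟩ := by
  classical
  have hσ (u : U) (t : ℝ) : t +ᵥ (τ (u, 0) : M) = τ (u, t) := by
    rw [← hτadd, zero_add]
  have hπσ (u : U) (t : ℝ) : π (t +ᵥ (τ (u, 0) : M)) = u := by rw [hσ, hτ]
  refine ⟨fun u => τ (u, 0), fun m => if hm : m ∈ π ⁻¹' U then (τ.symm ⟨m, hm⟩).2 else 0,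
    by fun_prop, ?_, fun u => hτ u 0, hπσ, fun u t => ?_, fun m hm => ?_⟩
  · rw [continuousOn_iff_continuous_domRestrict]
    have : Continuous fun m => (τ.symm m).2 := by fun_prop
    convert this using 1
    ext m
    simp only [domRestrict_apply, dif_pos m.2]
  · have hm : t +ᵥ (τ (u, 0) : M) ∈ π ⁻¹' U := by
      rw [mem_preimage, hπσ]
      exact u.2
    have he : (⟨_, hm⟩ : π ⁻¹' U) = τ (u, t) := Subtype.ext (hσ u t)
    beta_reduce
    rw [dif_pos hm, he, τ.symm_apply_apply]
  · have hm' : m ∈ π ⁻¹' U := hm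
    have hτm : (τ (τ.symm ⟨m, hm'⟩) : M) = m := by rw [τ.apply_symm_apply]
    have hu : (τ.symm ⟨m, hm'⟩).1 = ⟨π m, hm⟩ := by
      apply Subtype.ext
      rw [← hτ _ (τ.symm ⟨m, hm'⟩).2, Prod.mk.eta, hτm]
    beta_reduce
    rw [dif_pos hm', ← hu, hσ, Prod.mk.eta, hτm]

/-- Local equivariant functions over an open cover of a paracompact Hausdorff base average to a
global one. -/
lemma exists_continuous_equivariant_of_local
    {B M : Type*} [TopologicalSpace B] [ParacompactSpace B] [T2Space B]
    [TopologicalSpace M] [AddAction ℝ M] {π : M → B} (hπ : Continuous π)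
    (hinv : ∀ (t : ℝ) (m : M), π (t +ᵥ m) = π m)
    (U : B → Set B) (hU : ∀ b, IsOpen (U b)) (hmem : ∀ b, b ∈ U b)
    (g : B → M → ℝ) (hg : ∀ b, ContinuousOn (g b) (π ⁻¹' U b))
    (hadd : ∀ (b : B) (t : ℝ) (m : M), π m ∈ U b → g b (t +ᵥ m) = t + g b m) :
    ∃ h : M → ℝ, Continuous h ∧ ∀ (t : ℝ) (m : M), h (t +ᵥ m) = t + h m := by
  obtain ⟨ρ, hρ⟩ := PartitionOfUnity.exists_isSubordinate isClosed_univ U hU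
    fun b _ => mem_iUnion.2 ⟨b, hmem b⟩
  refine ⟨fun m => ∑ᶠ i, ρ i (π m) * g i m, ?_, fun t m => ?_⟩
  · refine continuous_finsum (fun i => ?_) ?_
    · rw [continuous_iff_continuousAt]
      intro m
      by_cases hm : π m ∈ tsupport (ρ i)
      · exact ((ρ i).continuous.comp hπ).continuousAt.mul
          ((hg i).continuousAt (((hU i).preimage hπ).mem_nhds (hρ i hm)))
      · have hev : ∀ᶠ x in 𝓝 m, π x ∉ tsupport (ρ i) :=
          hπ.continuousAt.eventually ((isClosed_tsupport _).isOpen_compl.mem_nhds hm)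
        refine (continuousAt_const (y := (0 : ℝ))).congr (hev.mono fun x hx => ?_)
        simp only [image_eq_zero_of_notMem_tsupport hx, zero_mul]
    · refine (ρ.locallyFinite.preimage_continuous hπ).subset fun i m hm => ?_
      exact left_ne_zero_of_mul hm
  · have hterm (i : B) : ρ i (π (t +ᵥ m)) * g i (t +ᵥ m)
        = ρ i (π m) * t + ρ i (π m) * g i m := by
      rw [hinv]
      by_cases hi : ρ i (π m) = 0
      · simp [hi]
      · rw [hadd i t m (hρ i (subset_tsupport _ hi)), mul_add]
    have hfin := ρ.locallyFinite.point_finite (π m)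
    simp only [hterm]
    rw [finsum_add_distrib (hfin.subset fun i hi => left_ne_zero_of_mul hi)
      (hfin.subset fun i hi => left_ne_zero_of_mul hi), ← finsum_mul', ρ.sum_eq_one (mem_univ _),
      one_mul]
    exact hfin


/-- **Triviality of principal ℝ-bundles over paracompact Hausdorff bases.**
If `π : M → B` is a principal `ℝ`-bundle (locally trivial, with the additive
group `ℝ` acting continuously on `M`, freely and transitively on fibers via the
local trivializations), then it admits a continuous global section `s`, and
`(b, t) ↦ t +ᵥ s b` is a homeomorphism `B × ℝ ≃ₜ M` intertwining the `ℝ`-action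
with translation in the `ℝ`-factor. -/
theorem principal_R_bundle_trivial
    {B M : Type*} [TopologicalSpace B] [ParacompactSpace B] [T2Space B]
    [TopologicalSpace M] [AddAction ℝ M]
    (hact : Continuous fun p : ℝ × M => p.1 +ᵥ p.2)
    (π : M → B) (hπ : Continuous π)
    (hloc : ∀ b : B, ∃ U : Set B, IsOpen U ∧ b ∈ U ∧
      ∃ τ : (U × ℝ) ≃ₜ (π ⁻¹' U),
        (∀ (u : U) (t : ℝ), π ((τ (u, t) : M)) = (u : B)) ∧
        (∀ (u : U) (t s : ℝ), ((τ (u, t + s) : M)) = s +ᵥ ((τ (u, t) : M)))) :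
    ∃ s : B → M, Continuous s ∧ (∀ b, π (s b) = b) ∧
      ∃ F : (B × ℝ) ≃ₜ M,
        (∀ (b : B) (t : ℝ), F (b, t) = t +ᵥ s b) ∧
        (∀ (b : B) (t r : ℝ), F (b, t + r) = r +ᵥ F (b, t)) := by
  choose U hU hmem τ hτ hτadd using hloc
  choose σ g hσ hg hπσ hπadd hgσ hdecomp using
    fun b => exists_local_section_and_coordinate (τ b) (hτ b) (hτadd b)
  have hinv (t : ℝ) (m : M) : π (t +ᵥ m) = π m := by
    rw [hdecomp (π m) m (hmem _), vadd_vadd, hπadd, hπadd]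
  have hadd (b : B) (t : ℝ) (m : M) (hm : π m ∈ U b) : g b (t +ᵥ m) = t + g b m := by
    conv_lhs => rw [hdecomp b m hm, vadd_vadd, hgσ]
  obtain ⟨h, hh, hhadd⟩ :=
    exists_continuous_equivariant_of_local hπ hinv U hU hmem g hg hadd
  set s : B → M := fun b => -h (σ b ⟨b, hmem b⟩) +ᵥ σ b ⟨b, hmem b⟩ with hs
  have hπs (b : B) : π (s b) = b := by rw [hs, hinv, hπσ]
  have hsπ (m : M) : s (π m) = -h m +ᵥ m := by
    have hm := hdecomp (π m) m (hmem _)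
    have hhm : h m = g (π m) m + h (σ (π m) ⟨π m, hmem _⟩) := by
      conv_lhs => rw [hm, hhadd]
    conv_rhs => rw [hhm, hm, vadd_vadd]
    simp only [hs]
    congr 1
    rw [← hm]
    ring
  have hhs (b : B) : h (s b) = 0 := by rw [hs, hhadd, neg_add_cancel]
  have hsc : Continuous s := by
    rw [continuous_iff_continuousAt]
    intro b
    refine ContinuousOn.continuousAt ?_ ((hU b).mem_nhds (hmem b))
    rw [continuousOn_iff_continuous_domRestrict]
    have : Continuous fun u => -h (σ b u) +ᵥ σ b u :=
      hact.comp ((hh.comp (hσ b)).neg.prodMk (hσ b))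
    convert this using 1
    ext u
    rw [domRestrict_apply, ← hsπ, hπσ]
  refine ⟨s, hsc, hπs, ⟨⟨fun p => p.2 +ᵥ s p.1, fun m => (π m, h m), fun p => ?_, fun m => ?_⟩,
    hact.comp (continuous_snd.prodMk (hsc.comp continuous_fst)), hπ.prodMk hh⟩,
    fun b t => rfl, fun b t r => ?_⟩
  · simp only [hinv, hπs, hhadd, hhs, add_zero]
  · simp only [hsπ, vadd_vadd, add_neg_cancel, zero_vadd]
  · change (t + r) +ᵥ s b = r +ᵥ t +ᵥ s b
    rw [add_comm, add_vadd]
end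

section
/- Let H be a closed subgroup of the 2-torus 𝕋² = (ℝ/ℤ)² which is isomorphic as a topological group to the circle ℝ/ℤ. Then there exists another closed subgroup K of 𝕋², also isomorphic as a topological group to ℝ/ℤ, such that the map K × H → 𝕋² sending (k,h) to k + h is an isomorphism of topological groups; that is, 𝕋² = K × H as an internal direct product. -/
/-- A continuous homomorphism from `ℝ` to the circle lifts to a linear map `ℝ → ℝ`. -/
theorem AddMonoidHom.exists_eq_coe_mul_of_continuous (f : ℝ →+ UnitAddCircle)
    (hf : Continuous f) : ∃ c : ℝ, ∀ x : ℝ, f x = ((x * c : ℝ) : UnitAddCircle) := by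
  have cov : IsCoveringMap ((↑) : ℝ → UnitAddCircle) :=
    (AddCircle.isAddQuotientCoveringMap_coe (1 : ℝ)).isCoveringMap
  obtain ⟨L, ⟨hL0, hL⟩, -⟩ := cov.existsUnique_continuousMap_lifts ⟨f, hf⟩ 0 0 (by simp)
  have hL (x : ℝ) : (L x : UnitAddCircle) = f x := congrFun hL x
  have hadd (x y : ℝ) : L (x + y) = L x + L y := by
    refine congrFun (cov.eq_of_comp_eq (g₁ := fun x ↦ L (x + y)) (g₂ := fun x ↦ L x + L y)
      (by fun_prop) (by fun_prop) ?_ 0 (by simp [hL0])) x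
    funext z
    simp [hL]
  refine ⟨L 1, fun x ↦ ?_⟩
  have h := map_real_smul (AddMonoidHom.mk' L hadd) L.continuous x 1
  simp only [smul_eq_mul, mul_one, AddMonoidHom.mk'_apply] at h
  rw [← h, hL]

/-- Every continuous endomorphism of the circle is multiplication by an integer. -/
theorem UnitAddCircle.exists_eq_zsmul_of_continuous (f : UnitAddCircle →+ UnitAddCircle)
    (hf : Continuous f) : ∃ n : ℤ, ∀ x, f x = n • x := by
  obtain ⟨c, hc⟩ := (f.comp (QuotientAddGroup.mk' _)).exists_eq_coe_mul_of_continuous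
    (hf.comp (AddCircle.continuous_mk' (1 : ℝ)))
  have hc (x : ℝ) : f (x : UnitAddCircle) = ((x * c : ℝ) : UnitAddCircle) := hc x
  have h1 : ((c : ℝ) : UnitAddCircle) = 0 := by
    rw [← one_mul c, ← hc, AddCircle.coe_period, map_zero]
  obtain ⟨n, hn⟩ := (AddCircle.coe_eq_zero_iff (1 : ℝ)).1 h1
  refine ⟨n, fun x ↦ ?_⟩
  induction x using QuotientAddGroup.induction_on with
  | H x =>
    rw [hc, ← AddCircle.coe_zsmul, ← hn]
    simp [mul_comm]

/-- If `x ↦ (a • x, b • x)` is injective on the circle, then `a` and `b` are coprime. -/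
theorem UnitAddCircle.isCoprime_of_zsmul_eq_zero {a b : ℤ}
    (h : ∀ x : UnitAddCircle, a • x = 0 → b • x = 0 → x = 0) : IsCoprime a b := by
  rw [Int.isCoprime_iff_gcd_eq_one]
  have key (N : ℕ) [NeZero N] (ha : (N : ℤ) ∣ a) (hb : (N : ℤ) ∣ b) : N = 1 := by
    have hz {c : ℤ} (hc : (N : ℤ) ∣ c) : c • ZMod.toAddCircle (1 : ZMod N) = 0 := by
      rw [← map_zsmul, ZMod.toAddCircle_eq_zero, zsmul_one, ZMod.intCast_zmod_eq_zero_iff_dvd]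
      exact hc
    have h1 := ZMod.toAddCircle_eq_zero.1 (h _ (hz ha) (hz hb))
    exact ZMod.one_eq_zero_iff.1 h1
  by_cases h0 : Int.gcd a b = 0
  · obtain ⟨rfl, rfl⟩ := Int.gcd_eq_zero_iff.1 h0
    exact absurd (key 2 (dvd_zero _) (dvd_zero _)) (by norm_num)
  · have : NeZero (Int.gcd a b) := ⟨h0⟩
    exact key _ (Int.gcd_dvd_left ..) (Int.gcd_dvd_right ..)

/-- **Splitting off a circle subgroup of the 2-torus.**
If `H` is a closed subgroup of `𝕋² = (ℝ/ℤ)²` isomorphic (as a topological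
group) to the circle `ℝ/ℤ`, then there is another closed subgroup `K`, also
isomorphic to the circle, such that `(k, h) ↦ k + h` is an isomorphism of
topological groups `K × H ≃ 𝕋²`. -/
theorem torus2_splits_circle_subgroup
    (H : AddSubgroup (AddCircle (1 : ℝ) × AddCircle (1 : ℝ)))
    (hH : IsClosed (H : Set (AddCircle (1 : ℝ) × AddCircle (1 : ℝ))))
    (hHcirc : ∃ e : H ≃+ AddCircle (1 : ℝ), Continuous e ∧ Continuous e.symm) :
    ∃ K : AddSubgroup (AddCircle (1 : ℝ) × AddCircle (1 : ℝ)),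
      IsClosed (K : Set (AddCircle (1 : ℝ) × AddCircle (1 : ℝ))) ∧
      (∃ e : K ≃+ AddCircle (1 : ℝ), Continuous e ∧ Continuous e.symm) ∧
      ∃ φ : (K × H) ≃+ (AddCircle (1 : ℝ) × AddCircle (1 : ℝ)),
        Continuous φ ∧ Continuous φ.symm ∧
        ∀ (k : K) (h : H), φ (k, h) =
          (k : AddCircle (1 : ℝ) × AddCircle (1 : ℝ)) +
          (h : AddCircle (1 : ℝ) × AddCircle (1 : ℝ)) := by
  obtain ⟨e, he, he'⟩ := hHcirc
  let g := H.subtype.comp e.symm.toAddMonoidHom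
  have hg : Continuous g := continuous_subtype_val.comp he'
  obtain ⟨a, ha⟩ := UnitAddCircle.exists_eq_zsmul_of_continuous
    ((AddMonoidHom.fst _ _).comp g) (continuous_fst.comp hg)
  obtain ⟨b, hb⟩ := UnitAddCircle.exists_eq_zsmul_of_continuous
    ((AddMonoidHom.snd _ _).comp g) (continuous_snd.comp hg)
  have hab (x : UnitAddCircle) :
      (e.symm x : UnitAddCircle × UnitAddCircle) = (a • x, b • x) := Prod.ext (ha x) (hb x)
  have hH' (h : H) : (h : UnitAddCircle × UnitAddCircle) = (a • e h, b • e h) := by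
    rw [← hab, e.symm_apply_apply]
  obtain ⟨u, v, huv⟩ : IsCoprime a b := by
    refine UnitAddCircle.isCoprime_of_zsmul_eq_zero fun x h₁ h₂ ↦ ?_
    have : e.symm x = 0 := Subtype.ext (by rw [hab, h₁, h₂]; rfl)
    simpa using this
  have hbez (x : UnitAddCircle) : (u * a + v * b) • x = x := by rw [huv, one_zsmul]
  let K := (AddMonoidHom.coprod (zsmulAddGroupHom u) (zsmulAddGroupHom v) :
    UnitAddCircle × UnitAddCircle →+ UnitAddCircle).ker
  have hK (p : UnitAddCircle × UnitAddCircle) : p ∈ K ↔ u • p.1 + v • p.2 = 0 := Iff.rfl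
  have hmem (x : UnitAddCircle) : (-v • x, u • x) ∈ K := by
    rw [hK]
    module
  let eK : K ≃+ UnitAddCircle :=
    { toFun k := a • k.1.2 - b • k.1.1
      invFun x := ⟨(-v • x, u • x), hmem x⟩
      left_inv := by
        rintro ⟨⟨p, q⟩, hk⟩
        rw [hK] at hk
        ext1
        refine Prod.ext ?_ ?_
        · linear_combination (norm := module) hbez p - a • hk
        · linear_combination (norm := module) hbez q - b • hk
      right_inv x := by
        linear_combination (norm := module) hbez x
      map_add' k l := by
        simp only [AddSubgroup.coe_add, Prod.fst_add, Prod.snd_add]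
        module }
  refine ⟨K, ?_, ⟨eK, ?_, ?_⟩,
    { toFun p := p.1 + p.2
      invFun p := (eK.symm (a • p.2 - b • p.1), e.symm (u • p.1 + v • p.2))
      left_inv := ?_
      right_inv := ?_
      map_add' p q := by
        simp only [Prod.fst_add, Prod.snd_add, AddSubgroup.coe_add]
        abel }, ?_, ?_, fun _ _ ↦ rfl⟩
  · exact isClosed_eq (f := fun p : UnitAddCircle × UnitAddCircle ↦ u • p.1 + v • p.2)
      (by fun_prop) continuous_const
  · change Continuous fun k : K ↦ a • k.1.2 - b • k.1.1
    fun_prop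
  · change Continuous fun x : UnitAddCircle ↦ (⟨(-v • x, u • x), hmem x⟩ : K)
    fun_prop
  · rintro ⟨k, h⟩
    have hk := (hK _).1 k.2
    refine Prod.ext (eK.symm_apply_eq.2 ?_) (e.symm_apply_eq.2 ?_)
    · change _ = a • k.1.2 - b • k.1.1
      simp only [hH' h, Prod.fst_add, Prod.snd_add]
      module
    · simp only [hH' h, Prod.fst_add, Prod.snd_add]
      linear_combination (norm := module) hk + hbez (e h)
  · rintro ⟨p, q⟩
    simp only [hab]
    refine Prod.ext ?_ ?_
    · change -v • (a • q - b • p) + a • (u • p + v • q) = p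
      linear_combination (norm := module) hbez p
    · change u • (a • q - b • p) + b • (u • p + v • q) = q
      linear_combination (norm := module) hbez q
  · change Continuous fun p : K × H ↦ (p.1 : UnitAddCircle × UnitAddCircle) + p.2
    fun_prop
  · change Continuous fun p : UnitAddCircle × UnitAddCircle ↦
      ((⟨(-v • (a • p.2 - b • p.1), u • (a • p.2 - b • p.1)), hmem _⟩ : K),
        e.symm (u • p.1 + v • p.2))
    fun_prop
end

section
/- Let H be a closed connected subgroup of the n-torus 𝕋ⁿ = (ℝ/ℤ)ⁿ. Then there exists a closed connected subgroup K of 𝕋ⁿ such that the map K × H → 𝕋ⁿ sending (k,h) to k + h is an isomorphism of topological groups; that is, 𝕋ⁿ = K × H as an internal direct product. -/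
open MeasureTheory Module

/-- The pairing `(m, x) ↦ ∑ i, m i • x i` between the character lattice `ℤⁿ` and the torus. -/
def torusPairing (n : ℕ) :
    (Fin n → ℤ) →ₗ[ℤ] (Fin n → AddCircle (1 : ℝ)) →ₗ[ℤ] AddCircle (1 : ℝ) :=
  LinearMap.mk₂ ℤ (fun m x ↦ ∑ i, m i • x i)
    (fun m m' x ↦ by simp [add_smul, Finset.sum_add_distrib])
    (fun c m x ↦ by simp [mul_smul, Finset.smul_sum])
    (fun m x y ↦ by simp [Finset.sum_add_distrib])
    (fun c m x ↦ by simp [Finset.smul_sum, smul_comm c])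

theorem torusPairing_apply {n : ℕ} (m : Fin n → ℤ) (x : Fin n → AddCircle (1 : ℝ)) :
    torusPairing n m x = ∑ i, m i • x i := rfl

theorem continuous_torusPairing {n : ℕ} (m : Fin n → ℤ) : Continuous (torusPairing n m) := by
  change Continuous fun x : Fin n → AddCircle (1 : ℝ) ↦ ∑ i, m i • x i
  fun_prop

theorem mFourier_eq_toCircle_torusPairing {n : ℕ} (m : Fin n → ℤ)
    (x : Fin n → AddCircle (1 : ℝ)) :
    UnitAddTorus.mFourier m x = ((torusPairing n m x).toCircle : ℂ) := by
  have h (s : Finset (Fin n)) :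
      ∏ i ∈ s, fourier (m i) (x i) = ((∑ i ∈ s, m i • x i).toCircle : ℂ) := by
    induction s using Finset.cons_induction with
    | empty => simp
    | cons i s hi ih =>
      rw [Finset.prod_cons, Finset.sum_cons, AddCircle.toCircle_add, ih, Circle.coe_mul,
        fourier_apply]
  exact h Finset.univ

theorem mFourier_add_apply {n : ℕ} (m : Fin n → ℤ) (x y : Fin n → AddCircle (1 : ℝ)) :
    UnitAddTorus.mFourier m (x + y) =
      UnitAddTorus.mFourier m x * UnitAddTorus.mFourier m y := by
  simp [mFourier_eq_toCircle_torusPairing, AddCircle.toCircle_add]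

/-- The lattice of characters of the torus that vanish on `H`. -/
def torusAnnihilator {n : ℕ} (H : AddSubgroup (Fin n → AddCircle (1 : ℝ))) :
    Submodule ℤ (Fin n → ℤ) where
  carrier := {m | ∀ h ∈ H, torusPairing n m h = 0}
  add_mem' ha hb h hh := by simp [ha h hh, hb h hh]
  zero_mem' h _ := by simp
  smul_mem' c m hm h hh := by rw [map_smul, LinearMap.smul_apply, hm h hh, smul_zero]

theorem mem_torusAnnihilator {n : ℕ} {H : AddSubgroup (Fin n → AddCircle (1 : ℝ))}
    {m : Fin n → ℤ} : m ∈ torusAnnihilator H ↔ ∀ h ∈ H, torusPairing n m h = 0 := Iff.rfl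

/-- The averages over a closed subgroup `H` of `f` and of its translate by a point killed by the
annihilator of `H` agree. -/
theorem integral_add_eq_of_torusAnnihilator {n : ℕ}
    {H : AddSubgroup (Fin n → AddCircle (1 : ℝ))} (μ : Measure H) [IsFiniteMeasure μ]
    [μ.IsAddLeftInvariant] [CompactSpace H] {x : Fin n → AddCircle (1 : ℝ)}
    (hx : ∀ m ∈ torusAnnihilator H, torusPairing n m x = 0)
    (f : C(UnitAddTorus (Fin n), ℂ)) :
    ∫ h : H, f (x + h) ∂μ = ∫ h : H, f h ∂μ := by
  have hint (g : H → ℂ) (hg : Continuous g) : Integrable g μ :=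
    hg.integrable_of_hasCompactSupport (HasCompactSupport.of_compactSpace g)
  have hmono (m : Fin n → ℤ) : ∫ h : H, UnitAddTorus.mFourier m (x + h) ∂μ =
      ∫ h : H, UnitAddTorus.mFourier m h ∂μ := by
    simp only [mFourier_add_apply, integral_const_mul]
    by_cases hm : m ∈ torusAnnihilator H
    · simp [mFourier_eq_toCircle_torusPairing m x, hx m hm]
    · simp only [mem_torusAnnihilator, not_forall] at hm
      obtain ⟨h₀, hh₀, hne⟩ := hm
      have hinv := integral_add_left_eq_self (μ := μ)
        (fun h : H ↦ UnitAddTorus.mFourier m (h : UnitAddTorus (Fin n))) ⟨h₀, hh₀⟩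
      have hne' : UnitAddTorus.mFourier m h₀ ≠ 1 := by
        rw [mFourier_eq_toCircle_torusPairing]
        intro h
        apply hne
        apply AddCircle.injective_toCircle one_ne_zero
        rw [AddCircle.toCircle_zero]
        exact Circle.ext h
      simp only [AddSubgroup.coe_add, mFourier_add_apply, integral_const_mul] at hinv
      have hzero : ∫ h : H, UnitAddTorus.mFourier m (h : UnitAddTorus (Fin n)) ∂μ = 0 := by
        by_contra h0
        exact hne' (mul_right_cancel₀ h0 (hinv.trans (one_mul _).symm))
      rw [hzero, mul_zero]
  have hcont (y : Fin n → AddCircle (1 : ℝ)) :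
      Continuous fun f : C(UnitAddTorus (Fin n), ℂ) ↦ ∫ h : H, f (y + h) ∂μ := by
    refine continuous_iff_continuousAt.mpr fun f₀ ↦ ?_
    refine continuousAt_of_dominated (bound := fun _ ↦ ‖f₀‖ + 1)
      (.of_forall fun f ↦ (hint _ (by fun_prop)).aestronglyMeasurable) ?_ (integrable_const _)
      (.of_forall fun h ↦ (continuous_eval_const _).continuousAt)
    filter_upwards [continuous_norm.continuousAt.eventually_lt_const (lt_add_one ‖f₀‖)] with f hf
    exact .of_forall fun h ↦ (f.norm_coe_le_norm _).trans hf.le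
  have hclosed : IsClosed {f : C(UnitAddTorus (Fin n), ℂ) |
      ∫ h : H, f (x + h) ∂μ = ∫ h : H, f h ∂μ} :=
    isClosed_eq (hcont x) (by simpa using hcont 0)
  have hspan : (Submodule.span ℂ (Set.range (UnitAddTorus.mFourier (d := Fin n))) : Set _) ⊆
      {f : C(UnitAddTorus (Fin n), ℂ) | ∫ h : H, f (x + h) ∂μ = ∫ h : H, f h ∂μ} := by
    intro g hg
    induction hg using Submodule.span_induction with
    | mem g hg =>
      obtain ⟨m, rfl⟩ := hg
      exact hmono m
    | zero => simp
    | add g₁ g₂ _ _ h₁ h₂ =>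
      simp only [Set.mem_ofPred_eq, ContinuousMap.add_apply] at *
      rw [integral_add (hint _ (by fun_prop)) (hint _ (by fun_prop)),
        integral_add (hint _ (by fun_prop)) (hint _ (by fun_prop)), h₁, h₂]
    | smul c g _ h =>
      simp only [Set.mem_ofPred_eq, ContinuousMap.smul_apply, integral_smul] at *
      rw [h]
  refine closure_minimal hspan hclosed ?_
  rw [← Submodule.topologicalClosure_coe, UnitAddTorus.span_mFourier_closure_eq_top]
  trivial

/-- A closed subgroup of the torus is the common kernel of the characters that vanish on it. -/
theorem mem_of_forall_mem_torusAnnihilator {n : ℕ}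
    {H : AddSubgroup (Fin n → AddCircle (1 : ℝ))}
    (hH : IsClosed (H : Set (Fin n → AddCircle (1 : ℝ)))) {x : Fin n → AddCircle (1 : ℝ)}
    (hx : ∀ m ∈ torusAnnihilator H, torusPairing n m x = 0) : x ∈ H := by
  by_contra hxH
  have : CompactSpace H := isCompact_iff_compactSpace.mp hH.isCompact
  let μ : Measure H := Measure.addHaar
  have hdisj : Disjoint (H : Set (Fin n → AddCircle (1 : ℝ))) ((fun y ↦ -x + y) ⁻¹' H) := by
    refine Set.disjoint_left.mpr fun y hy hy' ↦ hxH ?_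
    simpa using H.sub_mem hy hy'
  obtain ⟨f, hf0, hf1, -⟩ := exists_continuous_zero_one_of_isClosed hH
    (hH.preimage (continuous_const_add (-x))) hdisj
  have key := integral_add_eq_of_torusAnnihilator μ hx
    ((⟨Complex.ofReal, Complex.continuous_ofReal⟩ : C(ℝ, ℂ)).comp f)
  have e0 (h : H) : f h = 0 := hf0 h.2
  have e1 (h : H) : f (x + h) = 1 := hf1 (by simp)
  have hμ : μ.real Set.univ = 0 := by simpa [e0, e1] using key
  exact measureReal_univ_pos.ne' hμ

/-- Integer multiples of a character vanish on a connected subgroup only if the character does. -/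
theorem mem_torusAnnihilator_of_smul_mem {n : ℕ} {H : AddSubgroup (Fin n → AddCircle (1 : ℝ))}
    (hH : IsPreconnected (H : Set (Fin n → AddCircle (1 : ℝ)))) {k : ℤ} (hk : k ≠ 0)
    {m : Fin n → ℤ} (hm : k • m ∈ torusAnnihilator H) : m ∈ torusAnnihilator H := by
  have hfin : {u : AddCircle (1 : ℝ) | k • u = 0}.Finite :=
    AddCircle.finite_torsion_of_isSMulRegular_int _ _
      (.of_right_eq_zero_of_smul fun _ ↦ by simp [hk])
  intro h hh
  have hsub : torusPairing n m '' H ⊆ {u | k • u = 0} := by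
    rintro _ ⟨y, hy, rfl⟩
    have := hm y hy
    rwa [map_smul, LinearMap.smul_apply] at this
  simpa using hfin.countable.isTotallyDisconnected _ hsub
    (hH.image _ (continuous_torusPairing m).continuousOn) ⟨h, hh, rfl⟩ ⟨0, H.zero_mem, rfl⟩

/-- The annihilator of a connected subgroup is a direct summand of the character lattice. -/
theorem exists_isProj_torusAnnihilator {n : ℕ} {H : AddSubgroup (Fin n → AddCircle (1 : ℝ))}
    (hH : IsPreconnected (H : Set (Fin n → AddCircle (1 : ℝ)))) :
    ∃ P : (Fin n → ℤ) →ₗ[ℤ] (Fin n → ℤ), LinearMap.IsProj (torusAnnihilator H) P := by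
  have : IsTorsionFree ℤ ((Fin n → ℤ) ⧸ torusAnnihilator H) := by
    rw [isTorsionFree_iff_smul_eq_zero]
    intro k q hq
    obtain ⟨m, rfl⟩ := Submodule.mkQ_surjective _ q
    rw [or_iff_not_imp_left]
    intro hk
    rw [← map_smul] at hq
    simp only [Submodule.mkQ_apply, Submodule.Quotient.mk_eq_zero] at hq ⊢
    exact mem_torusAnnihilator_of_smul_mem hH hk hq
  obtain ⟨s, hs⟩ := projective_lifting_property (torusAnnihilator H).mkQ LinearMap.id
    (Submodule.mkQ_surjective _)
  refine ⟨LinearMap.id - s ∘ₗ (torusAnnihilator H).mkQ, fun m ↦ ?_, fun m hm ↦ ?_⟩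
  · rw [← Submodule.Quotient.mk_eq_zero, ← Submodule.mkQ_apply]
    have h := LinearMap.congr_fun hs ((torusAnnihilator H).mkQ m)
    rw [LinearMap.comp_apply, LinearMap.id_apply] at h
    rw [LinearMap.sub_apply, map_sub, LinearMap.comp_apply, h, LinearMap.id_apply, sub_self]
  · have : (torusAnnihilator H).mkQ m = 0 := by simpa using hm
    simp [this]

/-- The endomorphism of the torus dual to an endomorphism of the character lattice. -/
def torusDual {n : ℕ} (P : (Fin n → ℤ) →ₗ[ℤ] (Fin n → ℤ)) :
    (Fin n → AddCircle (1 : ℝ)) →ₗ[ℤ] (Fin n → AddCircle (1 : ℝ)) :=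
  LinearMap.pi fun i ↦ torusPairing n (P (Pi.single i 1))

theorem continuous_torusDual {n : ℕ} (P : (Fin n → ℤ) →ₗ[ℤ] (Fin n → ℤ)) :
    Continuous (torusDual P) :=
  continuous_pi fun _ ↦ continuous_torusPairing _

theorem torusPairing_torusDual {n : ℕ} (P : (Fin n → ℤ) →ₗ[ℤ] (Fin n → ℤ)) (m : Fin n → ℤ)
    (x : Fin n → AddCircle (1 : ℝ)) :
    torusPairing n m (torusDual P x) = torusPairing n (P m) x := by
  conv_rhs => rw [pi_eq_sum_univ' m]
  simp only [torusPairing_apply m, torusDual, LinearMap.pi_apply, map_sum, map_smul,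
    LinearMap.sum_apply, LinearMap.smul_apply]

theorem torusDual_torusDual {n : ℕ} {A : Submodule ℤ (Fin n → ℤ)}
    {P : (Fin n → ℤ) →ₗ[ℤ] (Fin n → ℤ)} (hP : LinearMap.IsProj A P)
    (x : Fin n → AddCircle (1 : ℝ)) : torusDual P (torusDual P x) = torusDual P x := by
  ext i
  change torusPairing n _ (torusDual P x) = torusPairing n _ x
  rw [torusPairing_torusDual, hP.map_id _ (hP.map_mem _)]

/-- An idempotent endomorphism splits an abelian group as the internal direct
product of its range and its kernel. -/
def AddMonoidHom.rangeProdKerEquiv {G : Type*} [AddCommGroup G] (Q : G →+ G)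
    (hQ : ∀ x, Q (Q x) = Q x) : Q.range × Q.ker ≃+ G where
  toFun p := p.1 + p.2
  invFun x := (⟨Q x, x, rfl⟩, ⟨x - Q x, by simp [AddMonoidHom.mem_ker, hQ]⟩)
  left_inv := by
    rintro ⟨⟨_, y, rfl⟩, ⟨z, hz⟩⟩
    rw [AddMonoidHom.mem_ker] at hz
    ext <;> simp [hQ, hz]
  right_inv x := by simp
  map_add' p q := by simp [add_add_add_comm]

/-- **Splitting off a closed connected subgroup of the n-torus.**
If `H` is a closed connected subgroup of `𝕋ⁿ = (ℝ/ℤ)ⁿ`, then there is a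
closed connected subgroup `K` such that `(k, h) ↦ k + h` is an isomorphism of
topological groups `K × H ≃ 𝕋ⁿ`. -/
theorem torus_splits_closed_connected_subgroup (n : ℕ)
    (H : AddSubgroup (Fin n → AddCircle (1 : ℝ)))
    (hHclosed : IsClosed (H : Set (Fin n → AddCircle (1 : ℝ))))
    (hHconn : IsConnected (H : Set (Fin n → AddCircle (1 : ℝ)))) :
    ∃ K : AddSubgroup (Fin n → AddCircle (1 : ℝ)),
      IsClosed (K : Set (Fin n → AddCircle (1 : ℝ))) ∧
      IsConnected (K : Set (Fin n → AddCircle (1 : ℝ))) ∧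
      ∃ φ : (K × H) ≃+ (Fin n → AddCircle (1 : ℝ)),
        Continuous φ ∧ Continuous φ.symm ∧
        ∀ (k : K) (h : H), φ (k, h) =
          (k : Fin n → AddCircle (1 : ℝ)) + (h : Fin n → AddCircle (1 : ℝ)) := by
  obtain ⟨P, hP⟩ := exists_isProj_torusAnnihilator hHconn.isPreconnected
  let Q : (Fin n → AddCircle (1 : ℝ)) →+ (Fin n → AddCircle (1 : ℝ)) :=
    (torusDual P).toAddMonoidHom
  have hQ (x) : Q (Q x) = Q x := torusDual_torusDual hP x
  have hQc : Continuous Q := continuous_torusDual P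
  obtain rfl : H = Q.ker := by
    ext x
    refine ⟨fun hx ↦ funext fun i ↦ hP.map_mem _ x hx, fun hx ↦ ?_⟩
    refine mem_of_forall_mem_torusAnnihilator hHclosed fun m hm ↦ ?_
    have hx' : torusDual P x = 0 := hx
    rw [← hP.map_id m hm, ← torusPairing_torusDual, hx', map_zero]
  have hrange : (Q.range : Set (Fin n → AddCircle (1 : ℝ))) = {x | Q x = x} := by
    ext x
    exact ⟨by rintro ⟨y, rfl⟩; exact hQ y, fun hx ↦ ⟨x, hx⟩⟩
  refine ⟨Q.range, ?_, ?_, Q.rangeProdKerEquiv hQ, ?_, ?_, fun _ _ ↦ rfl⟩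
  · rw [hrange]
    exact isClosed_eq hQc continuous_id
  · rw [AddMonoidHom.coe_range]
    exact isConnected_range hQc
  · change Continuous fun p : Q.range × Q.ker ↦
      (p.1 : Fin n → AddCircle (1 : ℝ)) + (p.2 : Fin n → AddCircle (1 : ℝ))
    fun_prop
  · exact (hQc.subtype_mk _).prodMk ((continuous_id.sub hQc).subtype_mk _)
end

section
/- Let H be a closed subgroup of the 2-torus 𝕋² = (ℝ/ℤ)² which is isomorphic as a topological group to the circle ℝ/ℤ. Then there exist relatively prime integers n and m such that H is the image of the one-parameter subgroup generated by the integral vector (n,m); that is, H = { (n t mod ℤ, m t mod ℤ) : t ∈ ℝ }. -/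
/-- A continuous endomorphism of the circle `ℝ/ℤ` is multiplication by an integer. -/
theorem AddCircle.exists_int_of_continuous_addMonoidHom
    (f : AddCircle (1 : ℝ) →+ AddCircle (1 : ℝ)) (hf : Continuous f) :
    ∃ n : ℤ, ∀ t : ℝ, f (t : AddCircle (1 : ℝ)) = (((n : ℝ) * t : ℝ) : AddCircle (1 : ℝ)) := by
  have cov : IsCoveringMap ((↑) : ℝ → AddCircle (1 : ℝ)) := AddCircle.isCoveringMap_coe 1
  obtain ⟨g, ⟨g_zero, g_lifts⟩, -⟩ := cov.existsUnique_continuousMap_lifts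
    (⟨fun t : ℝ ↦ f t, hf.comp (AddCircle.continuous_mk' 1)⟩ : C(ℝ, AddCircle (1 : ℝ)))
    0 0 (by simp)
  have hg (t : ℝ) : ((g t : ℝ) : AddCircle (1 : ℝ)) = f t := congrFun g_lifts t
  have g_add (x y : ℝ) : g (x + y) = g x + g y := by
    refine congrFun (cov.eq_of_comp_eq (g₁ := fun x ↦ g (x + y)) (g₂ := fun x ↦ g x + g y)
      (by fun_prop) (by fun_prop) ?_ 0 (by simp [g_zero])) x
    ext x
    simp [hg]
  have g_linear (t : ℝ) : g t = t * g 1 := by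
    simpa using map_real_smul (AddMonoidHom.mk' g g_add) g.continuous t 1
  obtain ⟨n, hn⟩ : ∃ n : ℤ, n • (1 : ℝ) = g 1 := by
    rw [← AddCircle.coe_eq_zero_iff, hg, AddCircle.coe_period, map_zero]
  refine ⟨n, fun t ↦ ?_⟩
  rw [← hg, g_linear, ← hn, zsmul_one, mul_comm]

/-- If `t ↦ (n t, m t)` has trivial kernel on the circle `ℝ/ℤ`, then `n` and `m` are coprime. -/
theorem AddCircle.isCoprime_of_forall_mul_eq_zero {n m : ℤ}
    (h : ∀ t : ℝ, (((n : ℝ) * t : ℝ) : AddCircle (1 : ℝ)) = 0 →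
      (((m : ℝ) * t : ℝ) : AddCircle (1 : ℝ)) = 0 → (t : AddCircle (1 : ℝ)) = 0) :
    IsCoprime n m := by
  rw [Int.isCoprime_iff_gcd_eq_one]
  by_contra hgcd
  obtain ⟨p, hp, hpn, hpm⟩ := Nat.Prime.not_coprime_iff_dvd.mp hgcd
  have hp0 : (p : ℝ) ≠ 0 := mod_cast hp.ne_zero
  have key {a : ℤ} (ha : p ∣ a.natAbs) :
      (((a : ℝ) * (p : ℝ)⁻¹ : ℝ) : AddCircle (1 : ℝ)) = 0 := by
    obtain ⟨b, rfl⟩ := Int.natCast_dvd.mpr ha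
    refine AddCircle.coe_eq_zero_iff 1 |>.mpr ⟨b, ?_⟩
    push_cast
    rw [zsmul_one]
    field_simp
  obtain ⟨k, hk⟩ := AddCircle.coe_eq_zero_iff 1 |>.mp (h _ (key hpn) (key hpm))
  rw [zsmul_one, ← one_div, eq_div_iff hp0] at hk
  have hk' : k * (p : ℤ) = 1 := by exact_mod_cast hk
  have : (p : ℤ) ∣ 1 := ⟨k, by rw [mul_comm, hk']⟩
  exact hp.one_lt.ne' (Nat.dvd_one.mp (by exact_mod_cast this))


/-- **Circle subgroups of the 2-torus are one-parameter subgroups with coprime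
integral direction.** If `H` is a closed subgroup of `𝕋² = (ℝ/ℤ)²` isomorphic
(as a topological group) to the circle `ℝ/ℤ`, then there are relatively prime
integers `n, m` such that `H = { ((n t : ℝ/ℤ), (m t : ℝ/ℤ)) : t ∈ ℝ }`. -/
theorem circle_subgroup_of_torus2_is_one_parameter
    (H : AddSubgroup (AddCircle (1 : ℝ) × AddCircle (1 : ℝ)))
    (hH : IsClosed (H : Set (AddCircle (1 : ℝ) × AddCircle (1 : ℝ))))
    (hHcirc : ∃ e : H ≃+ AddCircle (1 : ℝ), Continuous e ∧ Continuous e.symm) :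
    ∃ n m : ℤ, IsCoprime n m ∧
      (H : Set (AddCircle (1 : ℝ) × AddCircle (1 : ℝ))) =
        { p | ∃ t : ℝ, p = ((((n : ℝ) * t : ℝ) : AddCircle (1 : ℝ)),
                            (((m : ℝ) * t : ℝ) : AddCircle (1 : ℝ))) } := by
  obtain ⟨e, -, he⟩ := hHcirc
  let φ : AddCircle (1 : ℝ) →+ AddCircle (1 : ℝ) × AddCircle (1 : ℝ) :=
    H.subtype.comp e.symm.toAddMonoidHom
  have hφ : Continuous φ := continuous_subtype_val.comp he
  have φ_injective : Function.Injective φ := Subtype.val_injective.comp e.symm.injective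
  obtain ⟨n, hn⟩ := AddCircle.exists_int_of_continuous_addMonoidHom
    ((AddMonoidHom.fst _ _).comp φ) (continuous_fst.comp hφ)
  obtain ⟨m, hm⟩ := AddCircle.exists_int_of_continuous_addMonoidHom
    ((AddMonoidHom.snd _ _).comp φ) (continuous_snd.comp hφ)
  have φ_coe (t : ℝ) : φ t = ((((n : ℝ) * t : ℝ) : AddCircle (1 : ℝ)),
      (((m : ℝ) * t : ℝ) : AddCircle (1 : ℝ))) := Prod.ext (hn t) (hm t)
  refine ⟨n, m, AddCircle.isCoprime_of_forall_mul_eq_zero fun t h₁ h₂ ↦ ?_, ?_⟩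
  · apply φ_injective
    rw [φ_coe, h₁, h₂, map_zero, Prod.mk_zero_zero]
  · ext p
    constructor
    · intro hp
      obtain ⟨t, ht⟩ := QuotientAddGroup.mk_surjective (e ⟨p, hp⟩)
      refine ⟨t, ?_⟩
      rw [← φ_coe]
      change p = φ (QuotientAddGroup.mk t)
      rw [ht]
      simp [φ]
    · rintro ⟨t, rfl⟩
      rw [← φ_coe]
      exact (e.symm t).2
end

section
/- Let K₁ and K₂ be closed subgroups of the 2-torus 𝕋² = (ℝ/ℤ)², each isomorphic as a topological group to the circle ℝ/ℤ. Let B be the quotient topological space of [0,1] × 𝕋² by the equivalence relation generated by (0,g) ∼ (0, a+g) for all g ∈ 𝕋² and a ∈ K₁, and (1,g) ∼ (1, a+g) for all g ∈ 𝕋² and a ∈ K₂ (so B is obtained from the manifold with boundary [0,1] × 𝕋² by collapsing the K₁-orbits in one boundary component and the K₂-orbits in the other). Then B is not homeomorphic to the 3-torus 𝕋³ = (ℝ/ℤ)³. -/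
/-- Every continuous map `ℝ³ → ℝ/ℤ` lifts to `ℝ`. -/
theorem exists_continuous_real_lift (f : C(ℝ × ℝ × ℝ, AddCircle (1 : ℝ))) :
    ∃ F : C(ℝ × ℝ × ℝ, ℝ), ∀ x, (F x : AddCircle (1 : ℝ)) = f x := by
  obtain ⟨e, he⟩ := QuotientAddGroup.mk_surjective (f 0)
  obtain ⟨F, ⟨-, hF⟩, -⟩ :=
    (AddCircle.isCoveringMap_coe (1 : ℝ)).existsUnique_continuousMap_lifts f 0 e he
  exact ⟨F, fun x => congrFun hF x⟩

/-- A real-valued continuous function on a preconnected space that is constant modulo `ℤ`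
is constant. -/
theorem eq_of_continuous_of_coe_addCircle_eq {X : Type*} [TopologicalSpace X]
    [PreconnectedSpace X] {φ : X → ℝ} (hφ : Continuous φ)
    (h : ∀ x y, (φ x : AddCircle (1 : ℝ)) = φ y) (x y : X) : φ x = φ y :=
  (AddCircle.isCoveringMap_coe (1 : ℝ)).const_of_comp hφ h x y

/-- Two real lifts of the same circle-valued map on a preconnected space differ by an integer. -/
theorem exists_int_eq_add_of_coe_addCircle_eq {X : Type*} [TopologicalSpace X]
    [PreconnectedSpace X] [Nonempty X] {φ ψ : X → ℝ} (hφ : Continuous φ) (hψ : Continuous ψ)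
    (h : ∀ x, (φ x : AddCircle (1 : ℝ)) = ψ x) : ∃ n : ℤ, ∀ x, φ x = ψ x + n := by
  have hz : ∀ x, ((φ x - ψ x : ℝ) : AddCircle (1 : ℝ)) = 0 := fun x => by
    rw [AddCircle.coe_sub, h, sub_self]
  obtain ⟨x₀⟩ := ‹Nonempty X›
  obtain ⟨n, hn⟩ := (AddCircle.coe_eq_zero_iff (1 : ℝ)).1 (hz x₀)
  refine ⟨n, fun x => ?_⟩
  have := eq_of_continuous_of_coe_addCircle_eq (hφ.sub hψ)
    (fun x y => by simp only [Pi.sub_apply]; rw [hz, hz]) x x₀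
  simp only [Pi.sub_apply] at this
  simp only [zsmul_eq_mul, mul_one] at hn
  linarith

/-- A continuous map `[0,1] × 𝕋² → ℝ/ℤ`, pulled back to `[0,1] × ℝ²`, lifts to a real function
which is quasi-periodic in both coordinates of `ℝ²`. -/
theorem exists_quasiperiodic_lift
    (f : C(Set.Icc (0 : ℝ) 1 × AddCircle (1 : ℝ) × AddCircle (1 : ℝ), AddCircle (1 : ℝ))) :
    ∃ (F : C(Set.Icc (0 : ℝ) 1 × ℝ × ℝ, ℝ)) (m : ℤ × ℤ),
      (∀ t x y, (F (t, x, y) : AddCircle (1 : ℝ)) = f (t, x, y)) ∧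
      (∀ t x y, F (t, x + 1, y) = F (t, x, y) + m.1) ∧
      (∀ t x y, F (t, x, y + 1) = F (t, x, y) + m.2) := by
  have hc : Continuous ((↑) : ℝ → AddCircle (1 : ℝ)) := AddCircle.continuous_mk' 1
  have hp : Continuous (Set.projIcc (0 : ℝ) 1 zero_le_one) := continuous_projIcc
  obtain ⟨F, hF⟩ := exists_continuous_real_lift
    ⟨fun x => f (Set.projIcc 0 1 zero_le_one x.1, (x.2.1 : AddCircle (1 : ℝ)), x.2.2),
      by fun_prop⟩
  simp only [ContinuousMap.coe_mk, Prod.forall] at hF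
  obtain ⟨m, hm⟩ := exists_int_eq_add_of_coe_addCircle_eq
    (φ := fun x : ℝ × ℝ × ℝ => F (x.1, x.2.1 + 1, x.2.2)) (ψ := F) (by fun_prop) (by fun_prop)
    (fun x => by rw [hF, ← Prod.mk.eta (p := x), ← Prod.mk.eta (p := x.2), hF]; simp)
  obtain ⟨n, hn⟩ := exists_int_eq_add_of_coe_addCircle_eq
    (φ := fun x : ℝ × ℝ × ℝ => F (x.1, x.2.1, x.2.2 + 1)) (ψ := F) (by fun_prop) (by fun_prop)
    (fun x => by rw [hF, ← Prod.mk.eta (p := x), ← Prod.mk.eta (p := x.2), hF]; simp)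
  refine ⟨⟨fun x => F (x.1, x.2), by fun_prop⟩, (m, n), fun t x y => ?_, fun t x y => hm (t, x, y),
    fun t x y => hn (t, x, y)⟩
  simp [hF]

/-- If `x ↦ n • x + c` on the circle lifts to a continuous real function, then `n = 0`. -/
theorem eq_zero_of_coe_eq_zsmul_add {γ : AddCircle (1 : ℝ) → ℝ} (hγ : Continuous γ) (n : ℤ)
    (c : AddCircle (1 : ℝ)) (h : ∀ x, (γ x : AddCircle (1 : ℝ)) = n • x + c) : n = 0 := by
  have hc : Continuous ((↑) : ℝ → AddCircle (1 : ℝ)) := AddCircle.continuous_mk' 1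
  have key := eq_of_continuous_of_coe_addCircle_eq (φ := fun t : ℝ => γ t - n • t) (by fun_prop)
    (fun x y => by simp only [AddCircle.coe_sub, AddCircle.coe_zsmul, h]; abel) 0 1
  have h1 : ((1 : ℝ) : AddCircle (1 : ℝ)) = ((0 : ℝ) : AddCircle (1 : ℝ)) := by
    simp
  simp only [h1, smul_zero, sub_zero, zsmul_eq_mul, mul_one] at key
  exact_mod_cast (by linarith : (n : ℝ) = 0)

/-- A function on `ℝ` that is `1`-periodic takes equal values at points with the same image in
`ℝ/ℤ`. -/
theorem eq_of_coe_addCircle_eq_of_periodic {α : Type*} {φ : ℝ → α} (hφ : Function.Periodic φ 1)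
    {x y : ℝ} (h : (x : AddCircle (1 : ℝ)) = y) : φ x = φ y := by
  rw [← hφ.lift_coe x, ← hφ.lift_coe y, h]

/-- A doubly periodic continuous function on `[0,1] × ℝ²` descends to `[0,1] × 𝕋²`. -/
theorem exists_continuous_descent {F : Set.Icc (0 : ℝ) 1 × ℝ × ℝ → ℝ} (hF : Continuous F)
    (h₁ : ∀ t x y, F (t, x + 1, y) = F (t, x, y)) (h₂ : ∀ t x y, F (t, x, y + 1) = F (t, x, y)) :
    ∃ G : Set.Icc (0 : ℝ) 1 × AddCircle (1 : ℝ) × AddCircle (1 : ℝ) → ℝ, Continuous G ∧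
      ∀ t (x y : ℝ), G (t, x, y) = F (t, x, y) := by
  have hq : IsOpenQuotientMap ((↑) : ℝ → AddCircle (1 : ℝ)) :=
    QuotientAddGroup.isOpenQuotientMap_mk
  have hQ := (IsOpenQuotientMap.id (X := Set.Icc (0 : ℝ) 1)).prodMap (hq.prodMap hq)
  have hlift : ∀ p q : Set.Icc (0 : ℝ) 1 × ℝ × ℝ,
      Prod.map id (Prod.map ((↑) : ℝ → AddCircle (1 : ℝ)) ((↑) : ℝ → AddCircle (1 : ℝ))) p =
        Prod.map id (Prod.map (↑) (↑)) q → F p = F q := by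
    rintro ⟨t, x, y⟩ ⟨t', x', y'⟩ h
    simp only [Prod.map_apply, Prod.mk.injEq, id] at h
    obtain ⟨rfl, hx, hy⟩ := h
    exact (eq_of_coe_addCircle_eq_of_periodic (φ := fun x => F (t, x, y))
      (fun x => h₁ t x y) hx).trans
      (eq_of_coe_addCircle_eq_of_periodic (φ := fun y => F (t, x', y)) (fun y => h₂ t x' y) hy)
  obtain ⟨G, rfl⟩ := (Function.factorsThrough_iff F).1 (fun p q => hlift p q)
  exact ⟨G, hQ.continuous_comp_iff.1 hF, fun _ _ _ => rfl⟩

/-- Any three vectors of `ℤ²` are linearly dependent. -/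
theorem exists_int_relation (v : Fin 3 → ℤ × ℤ) : ∃ c : Fin 3 → ℤ, c ≠ 0 ∧ ∑ i, c i • v i = 0 := by
  have : ¬ LinearIndependent ℤ v := fun h => by
    have := h.fintype_card_le_finrank
    simp at this
  obtain ⟨c, hc, i, hi⟩ := Fintype.not_linearIndependent_iff.1 this
  exact ⟨c, fun h => hi (by simp [h]), hc⟩

/-- Some nontrivial integer combination of any three continuous maps `[0,1] × 𝕋² → ℝ/ℤ` lifts to
a continuous real function. -/
theorem exists_combination_lift
    (f : Fin 3 → C(Set.Icc (0 : ℝ) 1 × AddCircle (1 : ℝ) × AddCircle (1 : ℝ), AddCircle (1 : ℝ))) :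
    ∃ c : Fin 3 → ℤ, c ≠ 0 ∧
      ∃ G : Set.Icc (0 : ℝ) 1 × AddCircle (1 : ℝ) × AddCircle (1 : ℝ) → ℝ, Continuous G ∧
        ∀ p, (G p : AddCircle (1 : ℝ)) = ∑ i, c i • f i p := by
  choose F m hF h₁ h₂ using fun i => exists_quasiperiodic_lift (f i)
  obtain ⟨c, hc, hcm⟩ := exists_int_relation m
  have e₁ : ∑ i, (c i : ℝ) * (m i).1 = 0 := by
    have := congrArg Prod.fst hcm
    simp only [Prod.fst_sum, Prod.smul_fst, smul_eq_mul, Prod.fst_zero] at this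
    exact_mod_cast this
  have e₂ : ∑ i, (c i : ℝ) * (m i).2 = 0 := by
    have := congrArg Prod.snd hcm
    simp only [Prod.snd_sum, Prod.smul_snd, smul_eq_mul, Prod.snd_zero] at this
    exact_mod_cast this
  obtain ⟨G, hG, hGF⟩ := exists_continuous_descent (F := fun p => ∑ i, (c i : ℝ) * F i p)
    (by fun_prop) (fun t x y => by simp [h₁, mul_add, Finset.sum_add_distrib, e₁])
    (fun t x y => by simp [h₂, mul_add, Finset.sum_add_distrib, e₂])
  refine ⟨c, hc, G, hG, ?_⟩
  rintro ⟨t, x, y⟩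
  obtain ⟨x, rfl⟩ := QuotientAddGroup.mk_surjective x
  obtain ⟨y, rfl⟩ := QuotientAddGroup.mk_surjective y
  simp only [hGF, ← zsmul_eq_mul, Fin.sum_univ_three, AddCircle.coe_add, AddCircle.coe_zsmul, hF]

/-- No nontrivial integer combination of the coordinates of `𝕋³` lifts to a continuous real
function. -/
theorem eq_zero_of_torus3_combination_lift (c : Fin 3 → ℤ)
    {H : AddCircle (1 : ℝ) × AddCircle (1 : ℝ) × AddCircle (1 : ℝ) → ℝ} (hH : Continuous H)
    (h : ∀ z, (H z : AddCircle (1 : ℝ)) = c 0 • z.1 + c 1 • z.2.1 + c 2 • z.2.2) : c = 0 := by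
  have h0 := eq_zero_of_coe_eq_zsmul_add (γ := fun x => H (x, 0, 0)) (by fun_prop) (c 0) 0
    (fun x => by simp [h])
  have h1 := eq_zero_of_coe_eq_zsmul_add (γ := fun x => H (0, x, 0)) (by fun_prop) (c 1) 0
    (fun x => by simp [h])
  have h2 := eq_zero_of_coe_eq_zsmul_add (γ := fun x => H (0, 0, x)) (by fun_prop) (c 2) 0
    (fun x => by simp [h])
  ext i
  fin_cases i <;> simp [h0, h1, h2]

/-- A real function on `X × G` whose reduction modulo `ℤ` is invariant along the orbits of a
preconnected subgroup `K` in a slice is itself invariant along these orbits. -/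
theorem eq_of_mem_of_coe_addCircle_invariant {X G : Type*} [TopologicalSpace X]
    [TopologicalSpace G] [AddGroup G] [ContinuousAdd G] (K : AddSubgroup G) [PreconnectedSpace K]
    {φ : X × G → ℝ} (hφ : Continuous φ) {t : X} {g : G}
    (h : ∀ a ∈ K, (φ (t, a + g) : AddCircle (1 : ℝ)) = φ (t, g)) {a : G} (ha : a ∈ K) :
    φ (t, a + g) = φ (t, g) := by
  have := eq_of_continuous_of_coe_addCircle_eq (φ := fun k : K => φ (t, k + g)) (by fun_prop)
    (fun x y => by rw [h x x.2, h y y.2]) ⟨a, ha⟩ 0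
  simpa using this


/-- **The space obtained from `[0,1] × 𝕋²` by collapsing circle-subgroup orbits
in the two boundary components is not the 3-torus.** Let `K₁, K₂` be closed
subgroups of `𝕋² = (ℝ/ℤ)²`, each isomorphic as a topological group to the
circle `ℝ/ℤ`. Let `B` be the quotient of `[0,1] × 𝕋²` by the equivalence
relation generated by `(0, g) ∼ (0, a + g)` for `a ∈ K₁` and
`(1, g) ∼ (1, a + g)` for `a ∈ K₂`. Then `B` is not homeomorphic to `𝕋³`. -/
theorem collapsed_torus_cylinder_ne_torus3
    (K₁ K₂ : AddSubgroup (AddCircle (1 : ℝ) × AddCircle (1 : ℝ)))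
    (hK₁ : IsClosed (K₁ : Set (AddCircle (1 : ℝ) × AddCircle (1 : ℝ))))
    (hK₂ : IsClosed (K₂ : Set (AddCircle (1 : ℝ) × AddCircle (1 : ℝ))))
    (hK₁circ : ∃ e : K₁ ≃+ AddCircle (1 : ℝ), Continuous e ∧ Continuous e.symm)
    (hK₂circ : ∃ e : K₂ ≃+ AddCircle (1 : ℝ), Continuous e ∧ Continuous e.symm) :
    ¬ Nonempty
      ((Quot fun p q : (Set.Icc (0 : ℝ) 1) × (AddCircle (1 : ℝ) × AddCircle (1 : ℝ)) =>
          ((p.1 : ℝ) = 0 ∧ (q.1 : ℝ) = 0 ∧ ∃ a ∈ K₁, q.2 = a + p.2) ∨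
          ((p.1 : ℝ) = 1 ∧ (q.1 : ℝ) = 1 ∧ ∃ a ∈ K₂, q.2 = a + p.2)) ≃ₜ
        (AddCircle (1 : ℝ) × AddCircle (1 : ℝ) × AddCircle (1 : ℝ))) := by
  rintro ⟨Φ⟩
  obtain ⟨e₁, -, he₁⟩ := hK₁circ
  obtain ⟨e₂, -, he₂⟩ := hK₂circ
  have : PreconnectedSpace K₁ := e₁.symm.surjective.denseRange.preconnectedSpace he₁
  have : PreconnectedSpace K₂ := e₂.symm.surjective.denseRange.preconnectedSpace he₂
  have hπ := Φ.continuous.comp continuous_quot_mk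
  have hsound := fun p q => Quot.sound
    (r := fun p q : (Set.Icc (0 : ℝ) 1) × (AddCircle (1 : ℝ) × AddCircle (1 : ℝ)) =>
      ((p.1 : ℝ) = 0 ∧ (q.1 : ℝ) = 0 ∧ ∃ a ∈ K₁, q.2 = a + p.2) ∨
      ((p.1 : ℝ) = 1 ∧ (q.1 : ℝ) = 1 ∧ ∃ a ∈ K₂, q.2 = a + p.2)) (a := p) (b := q)
  obtain ⟨c, hc, G, hG, hGc⟩ := exists_combination_lift
    ![⟨_, hπ.fst⟩, ⟨_, hπ.snd.fst⟩, ⟨_, hπ.snd.snd⟩]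
  simp only [Fin.sum_univ_three, Matrix.cons_val, ContinuousMap.coe_mk, Function.comp_apply] at hGc
  have hinv : ∀ p q : (Set.Icc (0 : ℝ) 1) × (AddCircle (1 : ℝ) × AddCircle (1 : ℝ)),
      (((p.1 : ℝ) = 0 ∧ (q.1 : ℝ) = 0 ∧ ∃ a ∈ K₁, q.2 = a + p.2) ∨
      ((p.1 : ℝ) = 1 ∧ (q.1 : ℝ) = 1 ∧ ∃ a ∈ K₂, q.2 = a + p.2)) → G p = G q := by
    rintro ⟨s, g⟩ ⟨t, g'⟩ (⟨hs, ht, a, ha, rfl⟩ | ⟨hs, ht, a, ha, rfl⟩)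
    · obtain rfl : s = t := Subtype.ext (hs.trans ht.symm)
      refine (eq_of_mem_of_coe_addCircle_invariant K₁ hG (fun b hb => ?_) ha).symm
      rw [hGc, hGc, hsound (s, g) (s, b + g) (Or.inl ⟨hs, hs, b, hb, rfl⟩)]
    · obtain rfl : s = t := Subtype.ext (hs.trans ht.symm)
      refine (eq_of_mem_of_coe_addCircle_invariant K₂ hG (fun b hb => ?_) ha).symm
      rw [hGc, hGc, hsound (s, g) (s, b + g) (Or.inr ⟨hs, hs, b, hb, rfl⟩)]
  refine hc (eq_zero_of_torus3_combination_lift c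
    ((continuous_quot_lift hinv hG).comp Φ.symm.continuous) fun z => ?_)
  obtain ⟨w, rfl⟩ := Φ.surjective z
  obtain ⟨p, rfl⟩ := Quot.exists_rep w
  simpa using hGc p
end

section
/- Let E be a finite-dimensional real normed vector space, f : E → ℝ a C^∞ function, and p ∈ E a nondegenerate critical point of f: the derivative of f at p vanishes and the Hessian H of f at p is nondegenerate. Then there exist an open neighborhood U of 0 in E and a C^∞ open embedding φ : U → E with φ(0) = p such that f(φ(x)) = f(p) + ½·H(x,x) for all x ∈ U; that is, up to a smooth change of coordinates near p, f equals its value at p plus a nondegenerate quadratic form. -/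
open Set Filter Topology MeasureTheory
open scoped ContDiff

/-- A `C^n` function depending on a real parameter has a `C^n` integral over `[a, b]`. -/
theorem ContDiff.intervalIntegral_nat.{u} {E : Type u} [NormedAddCommGroup E] [NormedSpace ℝ E]
    [FiniteDimensional ℝ E] (a b : ℝ) (n : ℕ) :
    ∀ {G : Type u} [NormedAddCommGroup G] [NormedSpace ℝ G] [CompleteSpace G]
      {F : E → ℝ → G}, ContDiff ℝ n (Function.uncurry F) →
      ContDiff ℝ n fun y => ∫ t in a..b, F y t := by
  induction n with
  | zero =>
    intro G _ _ _ F hF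
    rw [Nat.cast_zero, contDiff_zero] at hF ⊢
    exact intervalIntegral.continuous_parametric_intervalIntegral_of_continuous' hF a b
  | succ n ih =>
    intro G _ _ _ F hF
    rw [Nat.cast_succ] at hF ⊢
    have hF' : ContDiff ℝ n (Function.uncurry fun (y : E) (t : ℝ) =>
        (fderiv ℝ (Function.uncurry F) (y, t)).comp (ContinuousLinearMap.inl ℝ E ℝ)) :=
      (hF.fderiv_right le_rfl).clm_comp contDiff_const
    refine contDiff_succ_iff_hasFDerivAt.2 ⟨_, ih hF', fun x => ?_⟩
    obtain ⟨C, hC⟩ := ((isCompact_closedBall x 1).prod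
      (isCompact_uIcc (a := a) (b := b))).exists_bound_of_continuousOn hF'.continuous.continuousOn
    have hcont (y : E) : Continuous (F y) :=
      hF.continuous.comp (by fun_prop : Continuous fun t => (y, t))
    have hFx' (y : E) : Continuous fun t =>
        (fderiv ℝ (Function.uncurry F) (y, t)).comp (ContinuousLinearMap.inl ℝ E ℝ) :=
      hF'.continuous.comp (by fun_prop : Continuous fun t : ℝ => (y, t))
    refine intervalIntegral.hasFDerivAt_integral_of_dominated_of_fderiv_le
      (bound := fun _ => C)
      (F' := fun y t =>
        (fderiv ℝ (Function.uncurry F) (y, t)).comp (ContinuousLinearMap.inl ℝ E ℝ))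
      (Metric.ball_mem_nhds x one_pos)
      (Eventually.of_forall fun y => (hcont y).aestronglyMeasurable)
      ((hcont x).intervalIntegrable a b)
      (hFx' x).aestronglyMeasurable ?_
      intervalIntegrable_const ?_
    · exact Eventually.of_forall fun t ht y hy =>
        hC (y, t) ⟨Metric.ball_subset_closedBall hy, uIoc_subset_uIcc ht⟩
    · exact Eventually.of_forall fun t _ y _ =>
        HasFDerivAt.comp (g := Function.uncurry F) y
          (hF.differentiable (by simp) (y, t)).hasFDerivAt (hasFDerivAt_prodMk_left (𝕜 := ℝ) y t)

/-- The average of a smooth function over the segment from `p` to `p + y`, with the weight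
`2 * (1 - t)` of the second order Taylor remainder, depends smoothly on `y`. -/
theorem ContDiff.exists_segment_average.{u} {E G : Type u} [NormedAddCommGroup E] [NormedSpace ℝ E]
    [FiniteDimensional ℝ E] [NormedAddCommGroup G] [NormedSpace ℝ G] [CompleteSpace G]
    {D : E → G} (hD : ContDiff ℝ ∞ D) (p : E) :
    ∃ B : E → G, ContDiff ℝ ∞ B ∧ B 0 = D p ∧
      ∀ (y : E) (L : G →L[ℝ] ℝ),
        L (B y) = ∫ t in (0 : ℝ)..1, 2 * (1 - t) * L (D (p + t • y)) := by
  have hF : ContDiff ℝ ∞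
      (Function.uncurry fun (y : E) (t : ℝ) => (2 * (1 - t)) • D (p + t • y)) :=
    (contDiff_const.mul (contDiff_const.sub contDiff_snd)).smul
      (hD.comp (contDiff_const.add (contDiff_snd.smul contDiff_fst)))
  refine ⟨fun y => ∫ t in (0 : ℝ)..1, (2 * (1 - t)) • D (p + t • y), ?_, ?_, fun y L => ?_⟩
  · exact contDiff_infty.2 fun n =>
      ContDiff.intervalIntegral_nat 0 1 n (hF.of_le (mod_cast le_top))
  · have : ∫ t in (0 : ℝ)..1, 2 * (1 - t) = 1 := by
      rw [intervalIntegral.integral_const_mul,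
        intervalIntegral.integral_sub (by simp) (by simp)]
      norm_num
    simp only [smul_zero, add_zero]
    rw [intervalIntegral.integral_smul_const, this, one_smul]
  · have hcont : Continuous fun t : ℝ => (2 * (1 - t)) • D (p + t • y) :=
      hF.continuous.comp (by fun_prop : Continuous fun t : ℝ => (y, t))
    rw [← L.intervalIntegral_comp_comm (hcont.intervalIntegrable _ _)]
    simp only [map_smul, smul_eq_mul]

/-- Second order Taylor expansion with a remainder given by a smooth family of symmetric
bilinear forms. -/
theorem ContDiff.exists_eq_taylor_two {E : Type*} [NormedAddCommGroup E] [NormedSpace ℝ E]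
    [FiniteDimensional ℝ E] {f : E → ℝ} (hf : ContDiff ℝ ∞ f) (p : E) :
    ∃ B : E → E →L[ℝ] E →L[ℝ] ℝ, ContDiff ℝ ∞ B ∧ B 0 = fderiv ℝ (fderiv ℝ f) p ∧
      (∀ y u v, B y u v = B y v u) ∧
      ∀ y, f (p + y) = f p + fderiv ℝ f p y + 1 / 2 * B y y y := by
  have hD : ContDiff ℝ ∞ (fderiv ℝ (fderiv ℝ f)) :=
    (hf.fderiv_right (m := ∞) le_rfl).fderiv_right le_rfl
  obtain ⟨B, hB, hB0, hBL⟩ := hD.exists_segment_average p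
  have hf2 : ContDiff ℝ (1 + 1) f := by
    rw [one_add_one_eq_two]
    exact contDiff_infty.1 hf 2
  have happ (y u v : E) : B y u v =
      ∫ t in (0 : ℝ)..1, 2 * (1 - t) * fderiv ℝ (fderiv ℝ f) (p + t • y) u v :=
    hBL y ((ContinuousLinearMap.apply ℝ ℝ v).comp (ContinuousLinearMap.apply ℝ (E →L[ℝ] ℝ) u))
  refine ⟨B, hB, hB0, fun y u v => ?_, fun y => ?_⟩
  · rw [happ, happ]
    refine intervalIntegral.integral_congr fun t _ => ?_
    exact congr_arg (2 * (1 - t) * ·)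
      (hf2.contDiffAt.isSymmSndFDerivAt (by simp [one_add_one_eq_two]) u v)
  · have h := map_add_eq_sum_add_integral_iteratedFDeriv (n := 1) (f := f) (x := p) (y := y)
      fun t _ => hf2.contDiffAt
    simp [Finset.sum_range_succ] at h
    simp only [iteratedFDeriv_two_apply] at h
    rw [h, happ]
    simp only [mul_assoc, intervalIntegral.integral_const_mul]
    ring

/-- Smooth inverse function theorem, with an inverse that is smooth on a whole neighborhood. -/
theorem ContDiffOn.exists_openPartialHomeomorph {E F : Type*} [NormedAddCommGroup E]
    [NormedSpace ℝ E] [CompleteSpace E] [NormedAddCommGroup F] [NormedSpace ℝ F]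
    {g : E → F} {s : Set E} {a : E} {g' : E ≃L[ℝ] F} (hs : IsOpen s) (ha : a ∈ s)
    (hg : ContDiffOn ℝ ∞ g s) (hg' : HasFDerivAt g (g' : E →L[ℝ] F) a) :
    ∃ e : OpenPartialHomeomorph E F, ⇑e = g ∧ a ∈ e.source ∧ e.source ⊆ s ∧
      ContDiffOn ℝ ∞ e.symm e.target := by
  have hat (x) (hx : x ∈ s) : ContDiffAt ℝ ∞ g x := hg.contDiffAt (hs.mem_nhds hx)
  have hD : ContinuousOn (fderiv ℝ g) s := hg.continuousOn_fderiv_of_isOpen hs (by simp)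
  set t := s ∩ fderiv ℝ g ⁻¹' range ((↑) : (E ≃L[ℝ] F) → E →L[ℝ] F)
  have ht : IsOpen t := hD.isOpen_inter_preimage hs ContinuousLinearEquiv.isOpen
  let e := (hat a ha).toOpenPartialHomeomorph g hg' (by simp)
  have hae : a ∈ e.source := (hat a ha).mem_toOpenPartialHomeomorph_source hg' (by simp)
  refine ⟨e.restrOpen t ht, rfl, ⟨hae, ha, g', hg'.fderiv.symm⟩, fun x hx => hx.2.1, ?_⟩
  intro y hy
  have hx : (e.restrOpen t ht).symm y ∈ e.source ∩ t := (e.restrOpen t ht).map_target hy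
  obtain ⟨L, hL⟩ := hx.2.2
  refine (OpenPartialHomeomorph.contDiffAt_symm _ hy (f₀' := L) ?_ (hat _ hx.2.1)).contDiffWithinAt
  rw [hL]
  exact ((hat _ hx.2.1).differentiableAt (by simp)).hasFDerivAt

/-- In a finite-dimensional algebra there is a square root, smooth near `1`, that preserves
a given subspace which contains `1` and is closed under squaring. -/
theorem Submodule.exists_contDiffOn_sqrt {A : Type*} [NormedRing A] [NormedAlgebra ℝ A]
    [FiniteDimensional ℝ A] (S : Submodule ℝ A) (h1 : (1 : A) ∈ S)
    (hmul : ∀ x ∈ S, x * x ∈ S) :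
    ∃ (V : Set A) (r : A → A), IsOpen V ∧ 1 ∈ V ∧ ContDiffOn ℝ ∞ r V ∧ r 1 = 1 ∧
      ∀ x ∈ V, x ∈ S → r x ∈ S ∧ r x * r x = x := by
  obtain ⟨P', hP'⟩ := S.subtype.exists_leftInverse_of_injective S.ker_subtype
  let P : A →L[ℝ] S := P'.toContinuousLinearMap
  have hP (x : S) : P x = x := LinearMap.congr_fun hP' x
  let sq : S → S := fun x => P (x * x)
  have hsq (x : S) : (sq x : A) = x * x := congr_arg Subtype.val (hP ⟨x * x, hmul x x.2⟩)
  let o : S := ⟨1, h1⟩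
  let L : S ≃L[ℝ] S := ContinuousLinearEquiv.smulLeft (Units.mk0 (2 : ℝ) two_ne_zero)
  have hcoe : ContDiff ℝ ∞ ((↑) : S → A) := S.subtypeL.contDiff
  have hsm : ContDiff ℝ ∞ sq := P.contDiff.comp (hcoe.mul hcoe)
  have hsqo : sq o = o := Subtype.ext (by simp [hsq, o])
  have hder : HasFDerivAt sq (L : S →L[ℝ] S) o := by
    have h := P.hasFDerivAt.comp o (S.subtypeL.hasFDerivAt.mul' (x := o) S.subtypeL.hasFDerivAt)
    refine h.congr_fderiv ?_
    ext x
    simp [L, o, ← two_smul ℝ (x : A), hP, Units.smul_def]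
  obtain ⟨e, he, ho, -, hes⟩ :=
    hsm.contDiffOn.exists_openPartialHomeomorph isOpen_univ (mem_univ o) hder
  have hPo : P 1 = o := hP o
  have hot : o ∈ e.target := by simpa [he, hsqo] using e.map_source ho
  refine ⟨P ⁻¹' e.target, fun x => e.symm (P x), e.open_target.preimage P.continuous,
    ?_, ?_, ?_, ?_⟩
  · rwa [mem_preimage, hPo]
  · exact hcoe.comp_contDiffOn (hes.comp P.contDiff.contDiffOn fun x hx => hx)
  · have := e.left_inv ho
    rw [he, hsqo] at this
    simp only [hPo, this, o]
  · intro x hx hxS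
    refine ⟨Subtype.prop _, ?_⟩
    rw [← hsq, ← he, e.right_inv hx]
    exact congr_arg Subtype.val (hP ⟨x, hxS⟩)

/-- **The Morse Lemma.** Let `f : E → ℝ` be a `C^∞` function on a
finite-dimensional real normed vector space and `p` a nondegenerate critical
point of `f` (the derivative of `f` vanishes at `p` and the Hessian `H` of `f`
at `p` is nondegenerate). Then there is a smooth change of coordinates near `p`
in which `f` equals `f(p)` plus the quadratic form `½ H(x,x)`: there are an
open neighborhood `U` of `0` and a `C^∞` open embedding `φ : U → E` with
`φ 0 = p` and `f (φ x) = f p + ½ H x x` on `U`. -/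
theorem morse_lemma
    {E : Type*} [NormedAddCommGroup E] [NormedSpace ℝ E] [FiniteDimensional ℝ E]
    (f : E → ℝ) (hf : ContDiff ℝ (⊤ : ℕ∞) f) (p : E)
    (hcrit : fderiv ℝ f p = 0)
    (H : E →L[ℝ] E →L[ℝ] ℝ) (hH : H = fderiv ℝ (fderiv ℝ f) p)
    (hnondeg : ∀ v : E, (∀ w : E, H v w = 0) → v = 0) :
    ∃ (U : Set E) (φ : E → E), IsOpen U ∧ (0 : E) ∈ U ∧ φ 0 = p ∧
      ContDiffOn ℝ (⊤ : ℕ∞) φ U ∧ IsOpen (φ '' U) ∧ Set.InjOn φ U ∧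
      (∃ ψ : E → E, ContDiffOn ℝ (⊤ : ℕ∞) ψ (φ '' U) ∧ ∀ x ∈ U, ψ (φ x) = x) ∧
      ∀ x ∈ U, f (φ x) = f p + (1 / 2) * H x x := by
  obtain ⟨B, hBs, hB0, hBsymm, hBf⟩ := hf.exists_eq_taylor_two p
  rw [← hH] at hB0
  have hHsymm (u v : E) : H u v = H v u := by rw [← hB0, hBsymm]
  -- `H` is an isomorphism from `E` onto its dual.
  have hinj : Function.Injective (H : E →ₗ[ℝ] E →L[ℝ] ℝ) :=
    (injective_iff_map_eq_zero _).2 fun v hv => hnondeg v fun w => by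
      simpa using DFunLike.congr_fun hv w
  have hrank : Module.finrank ℝ E = Module.finrank ℝ (E →L[ℝ] ℝ) :=
    Subspace.dual_finrank_eq.symm.trans
      (LinearMap.toContinuousLinearMap (𝕜 := ℝ) (E := E) (F' := ℝ)).finrank_eq
  let T : E ≃L[ℝ] E →L[ℝ] ℝ :=
    (LinearEquiv.ofInjectiveOfFinrankEq _ hinj hrank).toContinuousLinearEquiv
  have hT (ℓ : E →L[ℝ] ℝ) : H (T.symm ℓ) = ℓ := T.apply_symm_apply ℓ
  have hT' (v : E) : T.symm (H v) = v := T.symm_apply_apply v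
  let S : Submodule ℝ (E →L[ℝ] E) :=
    { carrier := {A | ∀ u v, H (A u) v = H u (A v)}
      add_mem' := fun ha hb u v => by simp [ha u v, hb u v]
      zero_mem' := fun u v => by simp
      smul_mem' := fun c a ha u v => by simp [ha u v] }
  obtain ⟨V, r, hV, h1V, hr, hr1, hrS⟩ := S.exists_contDiffOn_sqrt
    (fun u v => rfl) (fun a ha u v => (ha (a u) v).trans (ha u (a v)))
  -- `C y` represents `B y` with respect to `H`.
  let C : E → E →L[ℝ] E := fun y => (T.symm : (E →L[ℝ] ℝ) →L[ℝ] E).comp (B y)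
  have hC (y u : E) : H (C y u) = B y u := hT _
  have hCs : ContDiff ℝ ∞ C := contDiff_const.clm_comp hBs
  have hC0 : C 0 = 1 := by
    ext v
    simp [C, hB0, hT']
  have hCS (y : E) : C y ∈ S := fun u v => by
    rw [hC, hHsymm, hC, hBsymm]
  set s := C ⁻¹' V
  have hs : IsOpen s := hV.preimage hCs.continuous
  have h0s : (0 : E) ∈ s := by rwa [mem_preimage, hC0]
  have hR : ContDiffOn ℝ ∞ (fun y => r (C y)) s := hr.comp hCs.contDiffOn fun y hy => hy
  let χ : E → E := fun y => r (C y) y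
  have hχ : ContDiffOn ℝ ∞ χ s := hR.clm_apply contDiffOn_id
  have hχ0 : χ 0 = 0 := map_zero _
  have hχf (y : E) (hy : y ∈ s) : f (p + y) = f p + 1 / 2 * H (χ y) (χ y) := by
    obtain ⟨hmem, hsq⟩ := hrS (C y) hy (hCS y)
    have : r (C y) (χ y) = C y y := DFunLike.congr_fun hsq y
    rw [hmem y (χ y), this, hHsymm, hC, hBf, hcrit]
    simp
  have hder : HasFDerivAt χ (ContinuousLinearEquiv.refl ℝ E : E →L[ℝ] E) 0 := by
    have h := (((hR.contDiffAt (hs.mem_nhds h0s)).differentiableAt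
      (by simp)).hasFDerivAt).clm_apply (hasFDerivAt_id (0 : E))
    refine h.congr_fderiv ?_
    ext v
    simp [hC0, hr1]
  obtain ⟨e, he, h0e, hes, hesymm⟩ := hχ.exists_openPartialHomeomorph hs h0s hder
  have himage : (fun x => p + e.symm x) '' e.target = (fun z => z - p) ⁻¹' e.source := by
    rw [← e.symm_image_target_eq_source, ← image_image (p + ·) e.symm, image_add_left]
    simp [neg_add_eq_sub]
  refine ⟨e.target, fun x => p + e.symm x, e.open_target, ?_, ?_, contDiffOn_const.add hesymm,
    ?_, ?_, ⟨fun z => χ (z - p), ?_, fun x hx => ?_⟩, fun x hx => ?_⟩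
  · simpa [he, hχ0] using e.map_source h0e
  · simpa [he, hχ0] using e.left_inv h0e
  · rw [himage]
    exact e.open_source.preimage (by fun_prop)
  · exact fun x hx y hy hxy => e.symm.injOn hx hy (add_left_cancel hxy)
  · rw [himage]
    exact hχ.comp (by fun_prop) fun z hz => hes hz
  · simpa [he] using e.right_inv hx
  · rw [hχf _ (hes (e.map_target hx)), ← he, e.right_inv hx]
end
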